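/- (Tensor-power interpolation inequality, sandwiched version.) Let m ≥ 1 and let ρ be a positive semidefinite d^m×d^m complex matrix, viewed as an operator on the m-fold tensor power (ℂ^d)^{⊗m}. For α ∈ (1,∞) define G(α) := inf over positive definite d×d density matrices σ of (Tr[((σ^{⊗m})^{(1−α)/(2α)} ρ (σ^{⊗m})^{(1−α)/(2α)})^α])^{1/α}. Then for all α_0, α_1 ∈ (1,∞), θ ∈ [0,1], and α defined by 1/α = (1−θ)/α_0 + θ/α_1, one has G(α) ≤ G(α_0)^{1−θ}·G(α_1)^{θ}. -/

import Mathlib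

open Matrix
open scoped ComplexOrder

/-- Real power of a (hermitian) matrix via the continuous functional calculus. -/
noncomputable def mpow {ι : Type*} [Fintype ι] [DecidableEq ι]
    (A : Matrix ι ι ℂ) (r : ℝ) : Matrix ι ι ℂ :=
  cfc (fun x : ℝ => x ^ r) A

/-- Logarithm of a (hermitian) matrix via the continuous functional calculus. -/
noncomputable def mlog {ι : Type*} [Fintype ι] [DecidableEq ι]
    (A : Matrix ι ι ℂ) : Matrix ι ι ℂ :=
  cfc Real.log A

/-- Real part of the trace. -/
noncomputable def trR {ι : Type*} [Fintype ι] (A : Matrix ι ι ℂ) : ℝ :=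
  (Matrix.trace A).re

/-- Positive definite density matrices. -/
def Dens (d : ℕ) : Type :=
  {σ : Matrix (Fin d) (Fin d) ℂ // σ.PosDef ∧ σ.trace = 1}

/-- `m`-fold tensor (Kronecker) power of a `d × d` matrix, as a matrix indexed by
`Fin m → Fin d` (i.e., an operator on `(ℂ^d)^{⊗m}`). -/
noncomputable def tensPow {d : ℕ} (σ : Matrix (Fin d) (Fin d) ℂ) (m : ℕ) :
    Matrix (Fin m → Fin d) (Fin m → Fin d) ℂ :=
  fun x y => ∏ j, σ (x j) (y j)

lemma sum_rpow_mul_rpow_le {ι : Type*} {s : Finset ι} {f g : ι → ℝ}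
    (hf : ∀ i, 0 ≤ f i) (hg : ∀ i, 0 ≤ g i) {θ : ℝ} (hθ : θ ∈ Set.Icc (0 : ℝ) 1) :
    ∑ i ∈ s, f i ^ (1 - θ) * g i ^ θ ≤ (∑ i ∈ s, f i) ^ (1 - θ) * (∑ i ∈ s, g i) ^ θ := by
  rcases hθ.1.eq_or_lt with rfl | h0
  · simp
  rcases hθ.2.eq_or_lt with rfl | h1
  · simp
  have h1' : 0 < 1 - θ := by linarith
  have hpq : Real.HolderConjugate (1 - θ)⁻¹ θ⁻¹ :=
    Real.HolderConjugate.inv_inv h1' h0 (by ring)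
  have := Real.inner_le_Lp_mul_Lq_of_nonneg s hpq
    (fun i _ => Real.rpow_nonneg (hf i) (1 - θ)) (fun i _ => Real.rpow_nonneg (hg i) θ)
  simpa [← Real.rpow_mul (hf _), ← Real.rpow_mul (hg _), h0.ne', h1'.ne'] using this

lemma rpow_convexComb {t a₀ a₁ θ : ℝ} (ht : 0 ≤ t) (h : (1 - θ) * a₀ + θ * a₁ ≠ 0) :
    t ^ ((1 - θ) * a₀ + θ * a₁) = (t ^ a₀) ^ (1 - θ) * (t ^ a₁) ^ θ := by
  rw [Real.rpow_add' ht h, ← Real.rpow_mul ht, ← Real.rpow_mul ht, mul_comm a₀, mul_comm a₁]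

lemma rpow_one_sub_mul_rpow {t θ : ℝ} (ht : 0 ≤ t) : t ^ (1 - θ) * t ^ θ = t := by
  rw [← Real.rpow_add' ht (by simp), sub_add_cancel, Real.rpow_one]

lemma trR_nonneg {ι : Type*} [Fintype ι] {A : Matrix ι ι ℂ} (hA : A.PosSemidef) : 0 ≤ trR A :=
  (Complex.le_def.mp hA.trace_nonneg).1

lemma trR_smul {ι : Type*} [Fintype ι] (c : ℝ) (A : Matrix ι ι ℂ) :
    trR ((c : ℂ) • A) = c * trR A := by
  simp [trR, trace_smul]

/-- The diagonal complex matrix with real diagonal entries `x`. -/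
noncomputable def realDiagonal {ι : Type*} [DecidableEq ι] (x : ι → ℝ) : Matrix ι ι ℂ :=
  diagonal fun i => (x i : ℂ)

section RealDiagonal

variable {ι κ : Type*} [DecidableEq ι] [DecidableEq κ]

lemma realDiagonal_conjTranspose (x : ι → ℝ) : (realDiagonal x)ᴴ = realDiagonal x := by
  simp [realDiagonal, diagonal_conjTranspose, Pi.star_def]

lemma realDiagonal_smul (c : ℝ) (x : ι → ℝ) :
    (c : ℂ) • realDiagonal x = realDiagonal fun i => c * x i := by
  ext i j
  by_cases h : i = j <;> simp [realDiagonal, h]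

lemma realDiagonal_posSemidef {x : ι → ℝ} (hx : ∀ i, 0 ≤ x i) : (realDiagonal x).PosSemidef := by
  refine PosSemidef.diagonal ?_
  intro i
  simpa using hx i

variable [Fintype κ]

lemma isHermitian_conj_realDiagonal {μ : Type*} (W : Matrix μ κ ℂ) (x : κ → ℝ) :
    (W * realDiagonal x * Wᴴ).IsHermitian := by
  simp [IsHermitian, conjTranspose_mul, realDiagonal_conjTranspose, Matrix.mul_assoc]

lemma conj_realDiagonal_posSemidef {μ : Type*} [Fintype μ] (W : Matrix μ κ ℂ)
    {y : κ → ℝ} (hy : ∀ j, 0 ≤ y j) :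
    (W * realDiagonal y * Wᴴ).PosSemidef :=
  (realDiagonal_posSemidef hy).mul_mul_conjTranspose_same W

variable [Fintype ι]

lemma realDiagonal_mul (x y : ι → ℝ) :
    realDiagonal x * realDiagonal y = realDiagonal fun i => x i * y i := by
  simp [realDiagonal]

lemma exists_eq_conj_realDiagonal {A : Matrix ι ι ℂ} (hA : A.IsHermitian) :
    ∃ U : Matrix ι ι ℂ, ∃ x : ι → ℝ, Uᴴ * U = 1 ∧ U * Uᴴ = 1 ∧ A = U * realDiagonal x * Uᴴ ∧
      ∀ f : ℝ → ℝ, cfc f A = U * realDiagonal (fun i => f (x i)) * Uᴴ := by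
  refine ⟨hA.eigenvectorUnitary, hA.eigenvalues, ?_, ?_, ?_, fun f => ?_⟩
  · exact Unitary.coe_star_mul_self hA.eigenvectorUnitary
  · exact Unitary.coe_mul_star_self hA.eigenvectorUnitary
  · conv_lhs => rw [hA.spectral_theorem]
    rfl
  · rw [hA.cfc_eq]
    rfl

lemma cfc_conj_realDiagonal {U : Matrix ι ι ℂ} (hU : Uᴴ * U = 1) (x : ι → ℝ) (f : ℝ → ℝ) :
    cfc f (U * realDiagonal x * Uᴴ) = U * realDiagonal (fun i => f (x i)) * Uᴴ := by
  obtain ⟨V, y, hV, hV', hxy, hcfc⟩ :=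
    exists_eq_conj_realDiagonal (isHermitian_conj_realDiagonal U x)
  have hU' : U * Uᴴ = 1 := mul_eq_one_comm.mp hU
  have key : ∀ i j, (x i : ℂ) * (Uᴴ * V) i j = (Uᴴ * V) i j * y j := by
    have h : realDiagonal x * (Uᴴ * V) = (Uᴴ * V) * realDiagonal y := by
      calc realDiagonal x * (Uᴴ * V) = (Uᴴ * U) * realDiagonal x * Uᴴ * V := by
            rw [hU]; simp [Matrix.mul_assoc]
        _ = Uᴴ * (U * realDiagonal x * Uᴴ) * V := by simp only [Matrix.mul_assoc]
        _ = Uᴴ * V * realDiagonal y * (Vᴴ * V) := by rw [hxy]; simp only [Matrix.mul_assoc]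
        _ = _ := by rw [hV, Matrix.mul_one]
    intro i j
    simpa [realDiagonal] using congrFun (congrFun h i) j
  have h : realDiagonal (fun i => f (x i)) * (Uᴴ * V)
      = (Uᴴ * V) * realDiagonal (fun i => f (y i)) := by
    ext i j
    have := key i j
    simp only [realDiagonal, diagonal_mul, mul_diagonal]
    by_cases h0 : (Uᴴ * V) i j = 0
    · simp [h0]
    · rw [mul_comm, mul_right_inj' h0] at this
      rw [Complex.ofReal_inj.mp this, mul_comm]
  rw [hcfc f]
  calc V * realDiagonal (fun i => f (y i)) * Vᴴ
      = (U * Uᴴ) * V * realDiagonal (fun i => f (y i)) * Vᴴ := by rw [hU', Matrix.one_mul]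
    _ = U * ((Uᴴ * V) * realDiagonal (fun i => f (y i))) * Vᴴ := by simp only [Matrix.mul_assoc]
    _ = U * realDiagonal (fun i => f (x i)) * Uᴴ * (V * Vᴴ) := by
        rw [← h]; simp only [Matrix.mul_assoc]
    _ = _ := by rw [hV', Matrix.mul_one]

lemma mpow_conj_realDiagonal {U : Matrix ι ι ℂ} (hU : Uᴴ * U = 1) (x : ι → ℝ) (r : ℝ) :
    mpow (U * realDiagonal x * Uᴴ) r = U * realDiagonal (fun i => x i ^ r) * Uᴴ :=
  cfc_conj_realDiagonal hU x _

lemma Matrix.PosSemidef.exists_eq_conj_realDiagonal {A : Matrix ι ι ℂ} (hA : A.PosSemidef) :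
    ∃ U : Matrix ι ι ℂ, ∃ x : ι → ℝ, Uᴴ * U = 1 ∧ U * Uᴴ = 1 ∧ (∀ i, 0 ≤ x i) ∧
      A = U * realDiagonal x * Uᴴ := by
  obtain ⟨U, x, hU, hU', hx, -⟩ := _root_.exists_eq_conj_realDiagonal hA.isHermitian
  refine ⟨U, x, hU, hU', fun i => ?_, hx⟩
  have h : realDiagonal x = Uᴴ * A * U := by
    calc realDiagonal x = (Uᴴ * U) * realDiagonal x * (Uᴴ * U) := by simp [hU]
      _ = _ := by rw [hx]; simp only [Matrix.mul_assoc]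
  have h2 := (hA.conjTranspose_mul_mul_same U).diag_nonneg (i := i)
  rw [← h] at h2
  simpa [realDiagonal] using h2

lemma Matrix.PosDef.exists_eq_conj_realDiagonal {A : Matrix ι ι ℂ} (hA : A.PosDef) :
    ∃ U : Matrix ι ι ℂ, ∃ x : ι → ℝ, Uᴴ * U = 1 ∧ U * Uᴴ = 1 ∧ (∀ i, 0 < x i) ∧
      A = U * realDiagonal x * Uᴴ := by
  obtain ⟨U, x, hU, hU', hx, -⟩ := _root_.exists_eq_conj_realDiagonal hA.isHermitian
  refine ⟨U, x, hU, hU', fun i => ?_, hx⟩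
  have h : realDiagonal x = Uᴴ * A * U := by
    calc realDiagonal x = (Uᴴ * U) * realDiagonal x * (Uᴴ * U) := by simp [hU]
      _ = _ := by rw [hx]; simp only [Matrix.mul_assoc]
  have hinj : Function.Injective U.mulVec := by
    refine Function.LeftInverse.injective (g := Uᴴ.mulVec) fun v => ?_
    simp [mulVec_mulVec, hU]
  have h2 := (hA.conjTranspose_mul_mul_same hinj).diag_pos (i := i)
  rw [← h] at h2
  simpa [realDiagonal] using h2

lemma trR_conj_realDiagonal_mul (U : Matrix ι ι ℂ) (t : ι → ℝ) (W : Matrix ι κ ℂ) (y : κ → ℝ) :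
    trR (U * realDiagonal t * Uᴴ * (W * realDiagonal y * Wᴴ)) =
      ∑ p : ι × κ, t p.1 * ‖(Uᴴ * W) p.1 p.2‖ ^ 2 * y p.2 := by
  have h : (U * realDiagonal t * Uᴴ * (W * realDiagonal y * Wᴴ)).trace =
      (realDiagonal t * ((Uᴴ * W) * realDiagonal y * (Uᴴ * W)ᴴ)).trace := by
    rw [conjTranspose_mul, conjTranspose_conjTranspose, Matrix.mul_assoc, Matrix.mul_assoc,
      trace_mul_comm]
    simp only [Matrix.mul_assoc]
  rw [trR, h, Fintype.sum_prod_type, trace, Complex.re_sum]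
  refine Finset.sum_congr rfl fun i _ => ?_
  rw [diag_apply, realDiagonal, diagonal_mul, Complex.re_ofReal_mul, Matrix.mul_apply,
    Complex.re_sum, Finset.mul_sum]
  refine Finset.sum_congr rfl fun j _ => ?_
  rw [realDiagonal, mul_diagonal, conjTranspose_apply, mul_right_comm, Complex.star_def,
    Complex.mul_conj, ← Complex.ofReal_mul, Complex.ofReal_re, Complex.normSq_eq_norm_sq, mul_assoc]

lemma trR_conj_realDiagonal {U : Matrix ι ι ℂ} (hU : Uᴴ * U = 1) (x : ι → ℝ) :
    trR (U * realDiagonal x * Uᴴ) = ∑ i, x i := by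
  rw [trR, trace_mul_comm, ← Matrix.mul_assoc, hU, Matrix.one_mul, realDiagonal, trace_diagonal,
    Complex.re_sum]
  simp

/-- Log-convexity of `Tr (τ ^ a * W y Wᴴ)` when `a` varies affinely and `y` exponentially. -/
lemma trR_mpow_mul_conj_le {τ : Matrix ι ι ℂ} (hτ : τ.PosSemidef) (W : Matrix ι κ ℂ)
    {y₀ y₁ : κ → ℝ} (hy₀ : ∀ j, 0 ≤ y₀ j) (hy₁ : ∀ j, 0 ≤ y₁ j) {θ a₀ a₁ : ℝ}
    (hθ : θ ∈ Set.Icc (0 : ℝ) 1) (ha : (1 - θ) * a₀ + θ * a₁ ≠ 0) :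
    trR (mpow τ ((1 - θ) * a₀ + θ * a₁) *
        (W * realDiagonal (fun j => y₀ j ^ (1 - θ) * y₁ j ^ θ) * Wᴴ)) ≤
      trR (mpow τ a₀ * (W * realDiagonal y₀ * Wᴴ)) ^ (1 - θ) *
        trR (mpow τ a₁ * (W * realDiagonal y₁ * Wᴴ)) ^ θ := by
  obtain ⟨U, t, hU, -, ht, rfl⟩ := hτ.exists_eq_conj_realDiagonal
  simp only [mpow_conj_realDiagonal hU, trR_conj_realDiagonal_mul]
  refine le_trans (le_of_eq (Finset.sum_congr rfl fun p _ => ?_))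
    (sum_rpow_mul_rpow_le (fun p => ?_) (fun p => ?_) hθ)
  · have h1 := Real.rpow_nonneg (ht p.1) a₀
    have h2 := Real.rpow_nonneg (ht p.1) a₁
    have h3 : 0 ≤ ‖(Uᴴ * W) p.1 p.2‖ ^ 2 := by positivity
    rw [rpow_convexComb (ht p.1) ha, Real.mul_rpow (mul_nonneg h1 h3) (hy₀ _),
      Real.mul_rpow (mul_nonneg h2 h3) (hy₁ _), Real.mul_rpow h1 h3, Real.mul_rpow h2 h3]
    conv_lhs => rw [← rpow_one_sub_mul_rpow (θ := θ) h3]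
    ring
  · exact mul_nonneg (mul_nonneg (Real.rpow_nonneg (ht _) _) (by positivity)) (hy₀ _)
  · exact mul_nonneg (mul_nonneg (Real.rpow_nonneg (ht _) _) (by positivity)) (hy₁ _)

lemma sum_norm_sq_row {V : Matrix ι ι ℂ} (hV : V * Vᴴ = 1) (i : ι) : ∑ j, ‖V i j‖ ^ 2 = 1 := by
  have h := congrArg Complex.re (congrFun (congrFun hV i) i)
  rw [Matrix.mul_apply, Complex.re_sum, one_apply_eq, Complex.one_re] at h
  rw [← h]
  refine Finset.sum_congr rfl fun j _ => ?_
  rw [conjTranspose_apply, Complex.star_def, Complex.mul_conj, Complex.ofReal_re,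
    Complex.normSq_eq_norm_sq]

lemma sum_norm_sq_col {V : Matrix ι ι ℂ} (hV : Vᴴ * V = 1) (j : ι) : ∑ i, ‖V i j‖ ^ 2 = 1 := by
  have := sum_norm_sq_row (V := Vᴴ) (by simpa using hV) j
  simpa using this

/-- Hölder's inequality for the trace. -/
lemma trR_mpow_mul_mpow_le {A B : Matrix ι ι ℂ} (hA : A.PosSemidef) (hB : B.PosSemidef) {θ : ℝ}
    (hθ : θ ∈ Set.Icc (0 : ℝ) 1) :
    trR (mpow A (1 - θ) * mpow B θ) ≤ trR A ^ (1 - θ) * trR B ^ θ := by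
  obtain ⟨U, x, hU, hU', hx, rfl⟩ := hA.exists_eq_conj_realDiagonal
  obtain ⟨V, y, hV, hV', hy, rfl⟩ := hB.exists_eq_conj_realDiagonal
  have hUV : (Uᴴ * V) * (Uᴴ * V)ᴴ = 1 := by
    rw [conjTranspose_mul, conjTranspose_conjTranspose, Matrix.mul_assoc, ← Matrix.mul_assoc V,
      hV', Matrix.one_mul, hU]
  have hUV' : (Uᴴ * V)ᴴ * (Uᴴ * V) = 1 := mul_eq_one_comm.mp hUV
  rw [mpow_conj_realDiagonal hU, mpow_conj_realDiagonal hV, trR_conj_realDiagonal_mul,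
    trR_conj_realDiagonal hU, trR_conj_realDiagonal hV]
  have h1 : ∑ p : ι × ι, x p.1 * ‖(Uᴴ * V) p.1 p.2‖ ^ 2 = ∑ i, x i := by
    rw [Fintype.sum_prod_type]
    simp only [← Finset.mul_sum, sum_norm_sq_row hUV, mul_one]
  have h2 : ∑ p : ι × ι, y p.2 * ‖(Uᴴ * V) p.1 p.2‖ ^ 2 = ∑ i, y i := by
    rw [Fintype.sum_prod_type_right]
    simp only [← Finset.mul_sum, sum_norm_sq_col hUV', mul_one]
  rw [← h1, ← h2]
  refine le_trans (le_of_eq (Finset.sum_congr rfl fun p _ => ?_))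
    (sum_rpow_mul_rpow_le (fun p => ?_) (fun p => ?_) hθ)
  · have h3 : 0 ≤ ‖(Uᴴ * V) p.1 p.2‖ ^ 2 := by positivity
    rw [Real.mul_rpow (hx _) h3, Real.mul_rpow (hy _) h3]
    conv_lhs => rw [← rpow_one_sub_mul_rpow (θ := θ) h3]
    ring
  · exact mul_nonneg (hx _) (by positivity)
  · exact mul_nonneg (hy _) (by positivity)

lemma Matrix.PosSemidef.mpow {A : Matrix ι ι ℂ} (hA : A.PosSemidef) (r : ℝ) :
    (mpow A r).PosSemidef := by
  obtain ⟨U, x, hU, -, hx, rfl⟩ := hA.exists_eq_conj_realDiagonal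
  rw [mpow_conj_realDiagonal hU]
  exact (realDiagonal_posSemidef fun i => Real.rpow_nonneg (hx i) r).mul_mul_conjTranspose_same U

lemma mpow_mpow {A : Matrix ι ι ℂ} (hA : A.PosSemidef) (r s : ℝ) :
    mpow (mpow A r) s = mpow A (r * s) := by
  obtain ⟨U, x, hU, -, hx, rfl⟩ := hA.exists_eq_conj_realDiagonal
  simp only [mpow_conj_realDiagonal hU, Real.rpow_mul (hx _)]

lemma mpow_one {A : Matrix ι ι ℂ} (hA : A.PosSemidef) : mpow A 1 = A := by
  obtain ⟨U, x, hU, -, hx, rfl⟩ := hA.exists_eq_conj_realDiagonal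
  simp only [mpow_conj_realDiagonal hU, Real.rpow_one]

lemma mpow_mul_mpow {A : Matrix ι ι ℂ} (hA : A.PosDef) (r s : ℝ) :
    mpow A r * mpow A s = mpow A (r + s) := by
  obtain ⟨U, x, hU, -, hx, rfl⟩ := hA.exists_eq_conj_realDiagonal
  simp only [mpow_conj_realDiagonal hU, Real.rpow_add (hx _), ← realDiagonal_mul]
  calc _ = U * realDiagonal (fun i => x i ^ r) * (Uᴴ * U) *
        realDiagonal (fun i => x i ^ s) * Uᴴ := by simp only [Matrix.mul_assoc]
    _ = _ := by rw [hU, Matrix.mul_one]; simp only [Matrix.mul_assoc]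

lemma mpow_smul {A : Matrix ι ι ℂ} (hA : A.PosSemidef) {c : ℝ} (hc : 0 ≤ c) (r : ℝ) :
    mpow ((c : ℂ) • A) r = ((c ^ r : ℝ) : ℂ) • mpow A r := by
  obtain ⟨U, x, hU, -, hx, rfl⟩ := hA.exists_eq_conj_realDiagonal
  rw [mpow_conj_realDiagonal hU, ← smul_mul_assoc, ← mul_smul_comm, realDiagonal_smul,
    mpow_conj_realDiagonal hU, ← smul_mul_assoc, ← mul_smul_comm, realDiagonal_smul]
  simp only [Real.mul_rpow hc (hx _)]

lemma Matrix.PosDef.mpow {A : Matrix ι ι ℂ} (hA : A.PosDef) (r : ℝ) : (mpow A r).PosDef := by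
  have h := mpow_mul_mpow hA r (-r)
  have h0 : _root_.mpow A 0 = 1 := by
    obtain ⟨U, x, hU, hU', -, rfl⟩ := hA.exists_eq_conj_realDiagonal
    rw [mpow_conj_realDiagonal hU]
    simp [realDiagonal, hU']
  rw [add_neg_cancel, h0] at h
  exact (hA.posSemidef.mpow r).posDef_iff_isUnit.mpr (IsUnit.of_mul_eq_one _ h)

lemma mpow_half_mul_self {A : Matrix ι ι ℂ} (hA : A.PosSemidef) :
    mpow A (1 / 2) * mpow A (1 / 2) = A := by
  obtain ⟨U, x, hU, -, hx, rfl⟩ := hA.exists_eq_conj_realDiagonal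
  simp only [mpow_conj_realDiagonal hU]
  calc _ = U * realDiagonal (fun i => x i ^ (1 / 2 : ℝ)) * (Uᴴ * U) *
        realDiagonal (fun i => x i ^ (1 / 2 : ℝ)) * Uᴴ := by simp only [Matrix.mul_assoc]
    _ = U * (realDiagonal (fun i => x i ^ (1 / 2 : ℝ)) *
        realDiagonal (fun i => x i ^ (1 / 2 : ℝ))) * Uᴴ := by
        rw [hU, Matrix.mul_one]; simp only [Matrix.mul_assoc]
    _ = _ := by
        simp only [realDiagonal_mul, ← Real.sqrt_eq_rpow, Real.mul_self_sqrt (hx _)]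

lemma trR_mpow_mul_conjTranspose (L : Matrix ι ι ℂ) (r : ℝ) :
    trR (mpow (L * Lᴴ) r) = trR (mpow (Lᴴ * L) r) := by
  have key : ∀ {A : Matrix ι ι ℂ}, A.IsHermitian →
      trR (mpow A r) = (A.charpoly.roots.map fun z => z.re ^ r).sum := by
    intro A hA
    rw [hA.roots_charpoly_eq_eigenvalues, mpow, hA.cfc_eq, IsHermitian.cfc, trR,
      Unitary.conjStarAlgAut_apply, trace_mul_comm, ← Matrix.mul_assoc]
    simp [trace]
  rw [key (isHermitian_mul_conjTranspose_self L), key (isHermitian_conjTranspose_mul_self L),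
    charpoly_mul_comm]

/-- The Schatten `p`-norm of a positive semidefinite matrix. -/
noncomputable def schattenNorm (p : ℝ) (A : Matrix ι ι ℂ) : ℝ :=
  trR (mpow A p) ^ (1 / p)

lemma schattenNorm_nonneg {A : Matrix ι ι ℂ} (hA : A.PosSemidef) (p : ℝ) :
    0 ≤ schattenNorm p A :=
  Real.rpow_nonneg (trR_nonneg (hA.mpow p)) _

lemma schattenNorm_smul {A : Matrix ι ι ℂ} (hA : A.PosSemidef) {c p : ℝ} (hc : 0 ≤ c)
    (hp : p ≠ 0) : schattenNorm p ((c : ℂ) • A) = c * schattenNorm p A := by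
  rw [schattenNorm, mpow_smul hA hc, trR_smul,
    Real.mul_rpow (Real.rpow_nonneg hc p) (trR_nonneg (hA.mpow p)), one_div,
    Real.rpow_rpow_inv hc hp, schattenNorm, one_div]

lemma trR_mpow_mul_le_schattenNorm {τ M : Matrix ι ι ℂ} (hτ : τ.PosSemidef) (hτ1 : trR τ ≤ 1)
    (hM : M.PosSemidef) {p : ℝ} (hp : 1 < p) :
    trR (mpow τ (1 - 1 / p) * M) ≤ schattenNorm p M := by
  have hp0 : 0 < p := by linarith
  have hp1 : 1 / p ≤ 1 := by rw [div_le_one hp0]; exact hp.le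
  have h := trR_mpow_mul_mpow_le hτ (hM.mpow p) (θ := 1 / p) ⟨by positivity, hp1⟩
  rw [mpow_mpow hM, mul_one_div_cancel hp0.ne', mpow_one hM] at h
  refine h.trans (mul_le_of_le_one_left (schattenNorm_nonneg hM p) ?_)
  exact Real.rpow_le_one (trR_nonneg hτ) hτ1 (by linarith)

lemma exists_trR_mpow_mul_eq_schattenNorm {M : Matrix ι ι ℂ} (hM : M.PosSemidef) {p : ℝ}
    (hp : 1 < p) : ∃ τ : Matrix ι ι ℂ, τ.PosSemidef ∧ trR τ ≤ 1 ∧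
      trR (mpow τ (1 - 1 / p) * M) = schattenNorm p M := by
  have hp0 : 0 < p := by linarith
  set c := trR (mpow M p) with hc
  have hc0 : 0 ≤ c := trR_nonneg (hM.mpow p)
  refine ⟨((c⁻¹ : ℝ) : ℂ) • mpow M p, (hM.mpow p).smul ?_, ?_, ?_⟩
  · exact_mod_cast inv_nonneg.mpr hc0
  · rw [trR_smul, ← hc]
    exact inv_mul_le_one
  · have hmul : mpow M (p * (1 - 1 / p)) * M = mpow M p := by
      have hpe : p * (1 - 1 / p) = p - 1 := by field_simp
      rw [hpe]
      obtain ⟨U, x, hU, -, hx, rfl⟩ := hM.exists_eq_conj_realDiagonal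
      rw [mpow_conj_realDiagonal hU, mpow_conj_realDiagonal hU]
      calc _ = U * realDiagonal (fun i => x i ^ (p - 1)) * (Uᴴ * U) *
            realDiagonal x * Uᴴ := by simp only [Matrix.mul_assoc]
        _ = U * (realDiagonal (fun i => x i ^ (p - 1)) * realDiagonal x) * Uᴴ := by
            rw [hU, Matrix.mul_one]; simp only [Matrix.mul_assoc]
        _ = _ := by
            rw [realDiagonal_mul]
            congr 3
            ext i
            have := Real.rpow_add' (hx i) (y := p - 1) (z := 1) (by simpa using hp0.ne')
            rwa [sub_add_cancel, Real.rpow_one, eq_comm] at this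
    rw [mpow_smul (hM.mpow p) (inv_nonneg.mpr hc0), mpow_mpow hM, smul_mul_assoc, hmul, trR_smul,
      schattenNorm, ← hc]
    rcases hc0.eq_or_lt with h | h
    · rw [← h, mul_zero, Real.zero_rpow (by positivity)]
    · rw [Real.inv_rpow hc0, ← Real.rpow_neg hc0]
      nth_rewrite 2 [← Real.rpow_one c]
      rw [← Real.rpow_add h]
      congr 1
      ring

/-- Interpolation of Schatten norms along an exponential path of positive matrices. -/
lemma schattenNorm_conj_le (W : Matrix ι κ ℂ) {y₀ y₁ : κ → ℝ} (hy₀ : ∀ j, 0 ≤ y₀ j)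
    (hy₁ : ∀ j, 0 ≤ y₁ j) {θ p p₀ p₁ : ℝ} (hθ : θ ∈ Set.Icc (0 : ℝ) 1) (hp : 1 < p)
    (hp₀ : 1 < p₀) (hp₁ : 1 < p₁) (h : 1 / p = (1 - θ) / p₀ + θ / p₁) :
    schattenNorm p (W * realDiagonal (fun j => y₀ j ^ (1 - θ) * y₁ j ^ θ) * Wᴴ) ≤
      schattenNorm p₀ (W * realDiagonal y₀ * Wᴴ) ^ (1 - θ) *
        schattenNorm p₁ (W * realDiagonal y₁ * Wᴴ) ^ θ := by
  have hy : ∀ j, 0 ≤ y₀ j ^ (1 - θ) * y₁ j ^ θ := fun j =>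
    mul_nonneg (Real.rpow_nonneg (hy₀ j) _) (Real.rpow_nonneg (hy₁ j) _)
  obtain ⟨τ, hτ, hτ1, hτM⟩ :=
    exists_trR_mpow_mul_eq_schattenNorm (conj_realDiagonal_posSemidef W hy) hp
  have hexp : 1 - 1 / p = (1 - θ) * (1 - 1 / p₀) + θ * (1 - 1 / p₁) := by rw [h]; ring
  have hne : 1 - 1 / p ≠ 0 := by
    have : 1 / p < 1 := by rw [div_lt_one (by linarith)]; exact hp
    linarith
  rw [← hτM, hexp]
  refine (trR_mpow_mul_conj_le hτ W hy₀ hy₁ hθ (hexp ▸ hne)).trans ?_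
  have hnn : ∀ (a : ℝ) {y : κ → ℝ}, (∀ j, 0 ≤ y j) →
      0 ≤ trR (mpow τ a * (W * realDiagonal y * Wᴴ)) := by
    intro a y hy
    obtain ⟨U, t, hU, -, ht, rfl⟩ := hτ.exists_eq_conj_realDiagonal
    rw [mpow_conj_realDiagonal hU, trR_conj_realDiagonal_mul]
    exact Finset.sum_nonneg fun p _ =>
      mul_nonneg (mul_nonneg (Real.rpow_nonneg (ht _) _) (by positivity)) (hy _)
  have h1θ : 0 ≤ 1 - θ := by linarith [hθ.2]
  have hb₀ := trR_mpow_mul_le_schattenNorm hτ hτ1 (conj_realDiagonal_posSemidef W hy₀) hp₀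
  have hb₁ := trR_mpow_mul_le_schattenNorm hτ hτ1 (conj_realDiagonal_posSemidef W hy₁) hp₁
  exact mul_le_mul (Real.rpow_le_rpow (hnn _ hy₀) hb₀ h1θ)
    (Real.rpow_le_rpow (hnn _ hy₁) hb₁ hθ.1) (Real.rpow_nonneg (hnn _ hy₁) _)
    (Real.rpow_nonneg (schattenNorm_nonneg (conj_realDiagonal_posSemidef W hy₀) _) _)

lemma conj_realDiagonal_posDef {S T : Matrix ι ι ℂ} (hST : Sᴴ * T = 1) {x : ι → ℝ}
    (hx : ∀ i, 0 < x i) : (T * realDiagonal x * Tᴴ).PosDef := by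
  refine PosDef.mul_mul_conjTranspose_same (PosDef.diagonal fun i => by simpa using hx i) ?_
  refine Function.LeftInverse.injective (g := fun v => vecMul v Sᴴ) fun v => ?_
  simp [vecMul_vecMul, mul_eq_one_comm.mp hST]

lemma mpow_neg_one_conj_realDiagonal {S T : Matrix ι ι ℂ} (hST : Sᴴ * T = 1) {x : ι → ℝ}
    (hx : ∀ i, 0 < x i) :
    mpow (T * realDiagonal x * Tᴴ) (-1) = S * realDiagonal (fun i => (x i)⁻¹) * Sᴴ := by
  have hpd := conj_realDiagonal_posDef hST hx
  have hTS : T * Sᴴ = 1 := mul_eq_one_comm.mp hST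
  have hTS' : Tᴴ * S = 1 := by
    simpa [conjTranspose_mul] using congrArg conjTranspose hST
  have h1 : mpow (T * realDiagonal x * Tᴴ) (-1) * (T * realDiagonal x * Tᴴ) = 1 := by
    obtain ⟨U, y, hU, hU', hy, h⟩ := hpd.exists_eq_conj_realDiagonal
    rw [h, mpow_conj_realDiagonal hU]
    calc _ = U * realDiagonal (fun i => y i ^ (-1 : ℝ)) * (Uᴴ * U) *
          realDiagonal y * Uᴴ := by simp only [Matrix.mul_assoc]
      _ = U * (realDiagonal (fun i => y i ^ (-1 : ℝ)) * realDiagonal y) * Uᴴ := by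
          rw [hU, Matrix.mul_one]; simp only [Matrix.mul_assoc]
      _ = 1 := by
          rw [realDiagonal_mul]
          simp [Real.rpow_neg_one, (hy _).ne', realDiagonal, hU']
  have h2 : (T * realDiagonal x * Tᴴ) * (S * realDiagonal (fun i => (x i)⁻¹) * Sᴴ) = 1 := by
    calc _ = T * realDiagonal x * (Tᴴ * S) * realDiagonal (fun i => (x i)⁻¹) * Sᴴ := by
          simp only [Matrix.mul_assoc]
      _ = T * (realDiagonal x * realDiagonal (fun i => (x i)⁻¹)) * Sᴴ := by
          rw [hTS', Matrix.mul_one]; simp only [Matrix.mul_assoc]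
      _ = 1 := by
          rw [realDiagonal_mul]
          simp [(hx _).ne', realDiagonal, hTS]
  exact left_inv_eq_right_inv h1 h2

/-- Simultaneous diagonalization of two positive definite matrices by congruence. -/
lemma exists_conj_realDiagonal_pair {A B : Matrix ι ι ℂ} (hA : A.PosDef) (hB : B.PosDef) :
    ∃ S T : Matrix ι ι ℂ, ∃ x y : ι → ℝ, Sᴴ * T = 1 ∧ (∀ i, 0 < x i) ∧ (∀ i, 0 < y i) ∧
      A = T * realDiagonal x * Tᴴ ∧ B = T * realDiagonal y * Tᴴ := by
  obtain ⟨V, a, hV, hV', ha, hAV⟩ := hA.exists_eq_conj_realDiagonal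
  set R := realDiagonal (fun i => Real.sqrt (a i)) with hR
  set Q := realDiagonal (fun i => (Real.sqrt (a i))⁻¹) with hQ
  have hs : ∀ i, Real.sqrt (a i) ≠ 0 := fun i => (Real.sqrt_pos.mpr (ha i)).ne'
  have hRQ : R * Q = 1 := by
    rw [hR, hQ, realDiagonal_mul]; simp [hs, realDiagonal]
  have hQR : Q * R = 1 := mul_eq_one_comm.mp hRQ
  have hRR : R * R = realDiagonal a := by
    rw [hR, realDiagonal_mul]; simp only [Real.mul_self_sqrt (ha _).le]
  have hRs : Rᴴ = R := realDiagonal_conjTranspose _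
  have hQs : Qᴴ = Q := realDiagonal_conjTranspose _
  have hVQ : (V * Q)ᴴ * (V * R) = 1 := by
    rw [conjTranspose_mul, hQs, Matrix.mul_assoc, ← Matrix.mul_assoc Vᴴ, hV, Matrix.one_mul, hQR]
  have hVR : (V * R) * (V * Q)ᴴ = 1 := mul_eq_one_comm.mp hVQ
  have hinj : Function.Injective (V * Q).mulVec := by
    refine Function.LeftInverse.injective (g := (V * R)ᴴ.mulVec) fun v => ?_
    have : (V * R)ᴴ * (V * Q) = 1 := by
      simpa [conjTranspose_mul] using congrArg conjTranspose hVQ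
    rw [mulVec_mulVec, this, one_mulVec]
  obtain ⟨U, y, hU, hU', hy, hBU⟩ :=
    (hB.conjTranspose_mul_mul_same hinj).exists_eq_conj_realDiagonal
  refine ⟨V * Q * U, V * R * U, fun _ => 1, y, ?_, fun _ => one_pos, hy, ?_, ?_⟩
  · rw [conjTranspose_mul (V * Q), Matrix.mul_assoc, ← Matrix.mul_assoc (V * Q)ᴴ, hVQ,
      Matrix.one_mul, hU]
  · have h1 : realDiagonal (fun _ : ι => (1 : ℝ)) = 1 := by simp [realDiagonal]
    rw [h1, Matrix.mul_one, conjTranspose_mul, Matrix.mul_assoc, ← Matrix.mul_assoc U, hU',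
      Matrix.one_mul, conjTranspose_mul, hRs, Matrix.mul_assoc, ← Matrix.mul_assoc R, hRR,
      ← Matrix.mul_assoc, ← hAV]
  · calc B = ((V * R) * (V * Q)ᴴ) * B * ((V * R) * (V * Q)ᴴ)ᴴ := by
          rw [hVR, conjTranspose_one, Matrix.one_mul, Matrix.mul_one]
      _ = (V * R) * ((V * Q)ᴴ * B * (V * Q)) * (V * R)ᴴ := by
          rw [conjTranspose_mul (V * R), conjTranspose_conjTranspose]
          simp only [Matrix.mul_assoc]
      _ = _ := by
          rw [hBU, conjTranspose_mul (V * R) U]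
          simp only [Matrix.mul_assoc]

end RealDiagonal

section TensorPower

variable {d : ℕ}

lemma tensPow_mul (A B : Matrix (Fin d) (Fin d) ℂ) (m : ℕ) :
    tensPow (A * B) m = tensPow A m * tensPow B m := by
  ext x y
  simp only [tensPow, Matrix.mul_apply, Finset.prod_univ_sum, Fintype.piFinset_univ,
    Finset.prod_mul_distrib]

lemma tensPow_conjTranspose (A : Matrix (Fin d) (Fin d) ℂ) (m : ℕ) :
    tensPow Aᴴ m = (tensPow A m)ᴴ := by
  ext x y
  simp [tensPow, conjTranspose_apply]

lemma tensPow_smul (c : ℂ) (A : Matrix (Fin d) (Fin d) ℂ) (m : ℕ) :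
    tensPow (c • A) m = c ^ m • tensPow A m := by
  ext x y
  simp [tensPow, Finset.prod_mul_distrib]

lemma tensPow_realDiagonal (x : Fin d → ℝ) (m : ℕ) :
    tensPow (realDiagonal x) m = realDiagonal fun k : Fin m → Fin d => ∏ j, x (k j) := by
  ext k l
  by_cases h : k = l
  · subst h
    simp [tensPow, realDiagonal]
  · obtain ⟨j, hj⟩ := Function.ne_iff.mp h
    have h0 : realDiagonal (fun k : Fin m → Fin d => ∏ j, x (k j)) k l = 0 :=
      diagonal_apply_ne _ h
    rw [h0]
    exact Finset.prod_eq_zero (Finset.mem_univ j) (by simp [realDiagonal, hj])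

lemma tensPow_one (m : ℕ) : tensPow (1 : Matrix (Fin d) (Fin d) ℂ) m = 1 := by
  have h := tensPow_realDiagonal (fun _ : Fin d => (1 : ℝ)) m
  simpa [realDiagonal] using h

lemma tensPow_conj_realDiagonal (W : Matrix (Fin d) (Fin d) ℂ) (x : Fin d → ℝ) (m : ℕ) :
    tensPow (W * realDiagonal x * Wᴴ) m =
      tensPow W m * realDiagonal (fun k : Fin m → Fin d => ∏ j, x (k j)) * (tensPow W m)ᴴ := by
  rw [tensPow_mul, tensPow_mul, tensPow_realDiagonal, tensPow_conjTranspose]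

lemma mpow_tensPow {A : Matrix (Fin d) (Fin d) ℂ} (hA : A.PosSemidef) (m : ℕ) (r : ℝ) :
    mpow (tensPow A m) r = tensPow (mpow A r) m := by
  obtain ⟨U, x, hU, -, hx, rfl⟩ := hA.exists_eq_conj_realDiagonal
  have hUm : (tensPow U m)ᴴ * tensPow U m = 1 := by
    rw [← tensPow_conjTranspose, ← tensPow_mul, hU, tensPow_one]
  rw [mpow_conj_realDiagonal hU, tensPow_conj_realDiagonal, tensPow_conj_realDiagonal,
    mpow_conj_realDiagonal hUm]
  congr 3
  ext k
  exact (Real.finsetProd_rpow _ _ (fun j _ => hx (k j)) r).symm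

variable {m : ℕ} {ρ : Matrix (Fin m → Fin d) (Fin m → Fin d) ℂ}

lemma trR_mpow_sandwich_eq_schattenNorm (hρ : ρ.PosSemidef) {σ : Matrix (Fin d) (Fin d) ℂ}
    (hσ : σ.PosDef) {α : ℝ} (hα : 1 < α) :
    trR (mpow (mpow (tensPow σ m) ((1 - α) / (2 * α)) * ρ *
        mpow (tensPow σ m) ((1 - α) / (2 * α))) α) ^ (1 / α) =
      schattenNorm α (mpow ρ (1 / 2) * tensPow (mpow σ (-(1 - 1 / α))) m *
        (mpow ρ (1 / 2))ᴴ) := by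
  set r := (1 - α) / (2 * α) with hr
  set K := mpow ρ (1 / 2) with hK
  have hKs : Kᴴ = K := (hρ.mpow _).isHermitian
  have hrr : -(1 - 1 / α) = r + r := by
    have : α ≠ 0 := by linarith
    rw [hr]
    field_simp
    ring
  have hQs : (tensPow (mpow σ r) m)ᴴ = tensPow (mpow σ r) m := by
    rw [← tensPow_conjTranspose, (hσ.posSemidef.mpow r).isHermitian.eq]
  rw [schattenNorm, mpow_tensPow hσ.posSemidef, hrr, ← mpow_mul_mpow hσ, tensPow_mul]
  set Q := tensPow (mpow σ r) m with hQ
  have h1 : Q * ρ * Q = (Q * K) * (Q * K)ᴴ := by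
    rw [conjTranspose_mul, hQs, hKs, ← mpow_half_mul_self hρ, ← hK]
    simp only [Matrix.mul_assoc]
  have h2 : K * (Q * Q) * Kᴴ = (Q * K)ᴴ * (Q * K) := by
    rw [conjTranspose_mul, hQs, hKs]
    simp only [Matrix.mul_assoc]
  rw [h1, h2, trR_mpow_mul_conjTranspose]

lemma Dens.posDef (σ : Dens d) : σ.1.PosDef :=
  σ.2.1

lemma Dens.trR_eq_one (σ : Dens d) : trR σ.1 = 1 := by
  rw [trR, σ.2.2, Complex.one_re]

lemma schattenNorm_mpow_dens (σ : Dens d) {s : ℝ} (hs : s ≠ 0) :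
    schattenNorm (1 / s) (mpow σ.1 s) = 1 := by
  rw [schattenNorm, mpow_mpow σ.posDef.posSemidef, mul_one_div_cancel hs,
    mpow_one σ.posDef.posSemidef,
    σ.trR_eq_one, Real.one_rpow]

/-- A positive definite matrix of Schatten norm at most one is, up to a factor in `(0, 1]`,
dominated by the corresponding power of a density matrix. -/
lemma exists_dens_mpow_neg_eq (hd : 0 < d) {M : Matrix (Fin d) (Fin d) ℂ} (hM : M.PosDef) {s : ℝ}
    (hs : 0 < s) (hM1 : schattenNorm (1 / s) M ≤ 1) :
    ∃ σ : Dens d, ∃ c : ℝ, 0 ≤ c ∧ c ≤ 1 ∧ mpow σ.1 (-s) = (c : ℂ) • mpow M (-1) := by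
  have : Nonempty (Fin d) := ⟨⟨0, hd⟩⟩
  have hP := hM.mpow (1 / s)
  set c := trR (mpow M (1 / s)) with hc
  have htr : (mpow M (1 / s)).trace = (c : ℂ) :=
    Complex.ext rfl (by simpa using (Complex.le_def.mp hP.posSemidef.trace_nonneg).2.symm)
  have hc0 : 0 < c := by
    have := hP.trace_pos
    rw [htr] at this
    exact_mod_cast this
  have hcs : c ^ s ≤ 1 := by simpa [schattenNorm, hc] using hM1
  have hpd : (((c⁻¹ : ℝ) : ℂ) • mpow M (1 / s)).PosDef := by
    refine hP.smul ?_
    exact_mod_cast inv_pos.mpr hc0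
  refine ⟨⟨_, hpd, ?_⟩, c ^ s, by positivity, hcs, ?_⟩
  · rw [trace_smul, htr, smul_eq_mul, ← Complex.ofReal_mul, inv_mul_cancel₀ hc0.ne',
      Complex.ofReal_one]
  · rw [mpow_smul hP.posSemidef (inv_nonneg.mpr hc0.le), mpow_mpow hM.posSemidef, Real.rpow_neg
      (inv_nonneg.mpr hc0.le), Real.inv_rpow hc0.le, inv_inv]
    congr 2
    field_simp

lemma exists_dens_schattenNorm_le (hd : 0 < d) (K : Matrix (Fin m → Fin d) (Fin m → Fin d) ℂ)
    (σ₀ σ₁ : Dens d) {α₀ α₁ α θ : ℝ} (hα₀ : 1 < α₀) (hα₁ : 1 < α₁) (hα1 : 1 < α)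
    (hθ : θ ∈ Set.Icc (0 : ℝ) 1) (hα : 1 / α = (1 - θ) / α₀ + θ / α₁) :
    ∃ σ : Dens d, schattenNorm α (K * tensPow (mpow σ.1 (-(1 - 1 / α))) m * Kᴴ) ≤
      schattenNorm α₀ (K * tensPow (mpow σ₀.1 (-(1 - 1 / α₀))) m * Kᴴ) ^ (1 - θ) *
        schattenNorm α₁ (K * tensPow (mpow σ₁.1 (-(1 - 1 / α₁))) m * Kᴴ) ^ θ := by
  have hs : ∀ {a : ℝ}, 1 < a → 0 < 1 - 1 / a ∧ 1 < 1 / (1 - 1 / a) := by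
    intro a ha
    have h1 : 0 < 1 / a := by positivity
    have h2 : 1 / a < 1 := by rw [div_lt_one (by linarith)]; exact ha
    refine ⟨by linarith, ?_⟩
    rw [lt_div_iff₀ (by linarith)]
    linarith
  obtain ⟨S, T, x, y, hST, hx, hy, hA, hB⟩ := exists_conj_realDiagonal_pair
    (σ₀.posDef.mpow (1 - 1 / α₀)) (σ₁.posDef.mpow (1 - 1 / α₁))
  have hz : ∀ i, 0 < x i ^ (1 - θ) * y i ^ θ := fun i =>
    mul_pos (Real.rpow_pos_of_pos (hx i) _) (Real.rpow_pos_of_pos (hy i) _)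
  have hM1 := schattenNorm_conj_le T (fun i => (hx i).le) (fun i => (hy i).le) hθ (hs hα1).2
    (hs hα₀).2 (hs hα₁).2 (by
      rw [one_div_one_div, div_div_eq_mul_div, div_div_eq_mul_div, div_one, div_one, hα]
      ring)
  rw [← hA, ← hB, schattenNorm_mpow_dens _ (hs hα₀).1.ne', schattenNorm_mpow_dens _ (hs hα₁).1.ne',
    Real.one_rpow, Real.one_rpow, one_mul] at hM1
  obtain ⟨σ, c, hc0, hc1, hσ⟩ :=
    exists_dens_mpow_neg_eq hd (conj_realDiagonal_posDef hST hz) (hs hα1).1 hM1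
  refine ⟨σ, ?_⟩
  have hconj : ∀ u : Fin d → ℝ, K * tensPow (S * realDiagonal u * Sᴴ) m * Kᴴ =
      (K * tensPow S m) * realDiagonal (fun k : Fin m → Fin d => ∏ j, u (k j)) *
        (K * tensPow S m)ᴴ := by
    intro u
    rw [tensPow_conj_realDiagonal, conjTranspose_mul]
    simp only [Matrix.mul_assoc]
  have hneg : ∀ (τ : Dens d) (a : ℝ), mpow τ.1 (-a) = mpow (mpow τ.1 a) (-1) := by
    intro τ a
    rw [mpow_mpow τ.posDef.posSemidef, mul_neg_one]
  have hprod : ∀ {u : Fin d → ℝ}, (∀ i, 0 < u i) → ∀ k : Fin m → Fin d, 0 ≤ ∏ j, (u (k j))⁻¹ :=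
    fun hu k => Finset.prod_nonneg fun j _ => (inv_pos.mpr (hu _)).le
  rw [hσ, hneg σ₀, hneg σ₁, hA, hB, mpow_neg_one_conj_realDiagonal hST hx,
    mpow_neg_one_conj_realDiagonal hST hy, mpow_neg_one_conj_realDiagonal hST hz, tensPow_smul,
    mul_smul_comm, smul_mul_assoc, hconj, hconj, hconj, ← Complex.ofReal_pow,
    schattenNorm_smul (conj_realDiagonal_posSemidef _ (hprod hz)) (pow_nonneg hc0 m) (by linarith)]
  refine (mul_le_of_le_one_left (schattenNorm_nonneg
    (conj_realDiagonal_posSemidef _ (hprod hz)) _) (pow_le_one₀ hc0 hc1)).trans ?_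
  have hpath : (fun k : Fin m → Fin d => ∏ j, (x (k j) ^ (1 - θ) * y (k j) ^ θ)⁻¹) =
      fun k => (∏ j, (x (k j))⁻¹) ^ (1 - θ) * (∏ j, (y (k j))⁻¹) ^ θ := by
    ext k
    rw [← Real.finsetProd_rpow _ _ fun j _ => (inv_pos.mpr (hx (k j))).le,
      ← Real.finsetProd_rpow _ _ fun j _ => (inv_pos.mpr (hy (k j))).le, ← Finset.prod_mul_distrib]
    refine Finset.prod_congr rfl fun j _ => ?_
    rw [mul_inv, Real.inv_rpow (hx _).le, Real.inv_rpow (hy _).le]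
  rw [hpath]
  exact schattenNorm_conj_le _ (hprod hx) (hprod hy) hθ hα1 hα₀ hα₁ hα

lemma Dens.nonempty (hd : 0 < d) : Nonempty (Dens d) := by
  have hd' : (0 : ℂ) < (d : ℂ)⁻¹ := by
    rw [inv_pos]
    exact_mod_cast hd
  refine ⟨⟨(d : ℂ)⁻¹ • (1 : Matrix (Fin d) (Fin d) ℂ), PosDef.one.smul hd', ?_⟩⟩
  have : (d : ℂ) ≠ 0 := by exact_mod_cast hd.ne'
  simp [trace_smul, this]

end TensorPower

lemma le_iInf_rpow_mul_iInf_rpow {ι₀ ι₁ : Type*} [Nonempty ι₀] [Nonempty ι₁] {f : ι₀ → ℝ}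
    {g : ι₁ → ℝ} (hf : ∀ i, 0 ≤ f i) (hg : ∀ i, 0 ≤ g i) {a p q : ℝ} (hp : 0 ≤ p) (hq : 0 ≤ q)
    (h : ∀ i j, a ≤ f i ^ p * g j ^ q) : a ≤ (⨅ i, f i) ^ p * (⨅ j, g j) ^ q := by
  have hcont : Continuous fun ε : ℝ => ((⨅ i, f i) + ε) ^ p * ((⨅ j, g j) + ε) ^ q :=
    ((Real.continuous_rpow_const hp).comp (by fun_prop)).mul
      ((Real.continuous_rpow_const hq).comp (by fun_prop))
  have hlim := (hcont.tendsto 0).mono_left (nhdsWithin_le_nhds (s := Set.Ioi (0 : ℝ)))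
  simp only [add_zero] at hlim
  refine ge_of_tendsto hlim (eventually_nhdsWithin_of_forall fun ε hε => ?_)
  obtain ⟨i, hi⟩ := exists_lt_of_ciInf_lt (lt_add_of_pos_right (⨅ i, f i) hε)
  obtain ⟨j, hj⟩ := exists_lt_of_ciInf_lt (lt_add_of_pos_right (⨅ j, g j) hε)
  exact (h i j).trans (mul_le_mul (Real.rpow_le_rpow (hf i) hi.le hp)
    (Real.rpow_le_rpow (hg j) hj.le hq) (Real.rpow_nonneg (hg j) q)
    (Real.rpow_nonneg ((hf i).trans hi.le) p))

/-- tensor-power interpolation inequality, sandwiched version. -/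
theorem sandwiched_tensor_power_interpolation {d m : ℕ} (hd : 0 < d) (hm : 0 < m)
    (ρ : Matrix (Fin m → Fin d) (Fin m → Fin d) ℂ) (hρ : ρ.PosSemidef)
    (G : ℝ → ℝ)
    (hG : ∀ α : ℝ, G α = ⨅ σ : Dens d,
      trR (mpow (mpow (tensPow σ.1 m) ((1 - α) / (2 * α)) * ρ *
        mpow (tensPow σ.1 m) ((1 - α) / (2 * α))) α) ^ (1 / α))
    (α₀ α₁ α θ : ℝ) (hα₀ : 1 < α₀) (hα₁ : 1 < α₁)
    (hθ : θ ∈ Set.Icc (0 : ℝ) 1)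
    (hα : 1 / α = (1 - θ) / α₀ + θ / α₁) :
    G α ≤ G α₀ ^ (1 - θ) * G α₁ ^ θ := by

  have hα1 : 1 < α := by
    have h0 : 1 / α₀ < 1 := by rw [div_lt_one (by linarith)]; exact hα₀
    have h1 : 1 / α₁ < 1 := by rw [div_lt_one (by linarith)]; exact hα₁
    have h0' : 0 < 1 / α₀ := by positivity
    have h1' : 0 < 1 / α₁ := by positivity
    have he : 1 / α = (1 - θ) * (1 / α₀) + θ * (1 / α₁) := by rw [hα]; ring
    have hmem := (convex_Ioo (0 : ℝ) 1) ⟨h0', h0⟩ ⟨h1', h1⟩ (sub_nonneg.mpr hθ.2) hθ.1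
      (sub_add_cancel 1 θ)
    rw [smul_eq_mul, smul_eq_mul, ← he] at hmem
    have hα0 : 0 < α := one_div_pos.mp hmem.1
    exact (div_lt_one hα0).mp hmem.2
  have hnonempty := Dens.nonempty hd
  have hG' : ∀ a : ℝ, 1 < a → G a = ⨅ σ : Dens d, schattenNorm a
      (mpow ρ (1 / 2) * tensPow (mpow σ.1 (-(1 - 1 / a))) m * (mpow ρ (1 / 2))ᴴ) := fun a ha => by
    rw [hG a]
    exact iInf_congr fun σ => trR_mpow_sandwich_eq_schattenNorm hρ σ.posDef ha
  have hnn : ∀ (a : ℝ) (σ : Dens d), 0 ≤ schattenNorm a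
      (mpow ρ (1 / 2) * tensPow (mpow σ.1 (-(1 - 1 / a))) m * (mpow ρ (1 / 2))ᴴ) := fun a σ => by
    refine schattenNorm_nonneg (PosSemidef.mul_mul_conjTranspose_same ?_ _) a
    obtain ⟨U, x, -, -, hx, hU⟩ :=
      (σ.posDef.posSemidef.mpow (-(1 - 1 / a))).exists_eq_conj_realDiagonal
    rw [hU, tensPow_conj_realDiagonal]
    exact conj_realDiagonal_posSemidef _ fun k => Finset.prod_nonneg fun j _ => hx _
  rw [hG' α hα1, hG' α₀ hα₀, hG' α₁ hα₁]
  refine le_iInf_rpow_mul_iInf_rpow (hnn α₀) (hnn α₁) (sub_nonneg.mpr hθ.2) hθ.1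
    fun σ₀ σ₁ => ?_
  obtain ⟨σ, hσ⟩ := exists_dens_schattenNorm_le hd (mpow ρ (1 / 2)) σ₀ σ₁ hα₀ hα₁ hα1 hθ hα
  refine (ciInf_le ⟨0, ?_⟩ σ).trans hσ
  rintro _ ⟨τ, rfl⟩
  exact hnn α τ
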